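/- In the braid group B_N the pure braid relation P3 holds: for all 1 ≤ i < j < s ≤ N, a_{ij}⁻¹ a_{is} a_{ij} = a_{is} a_{js} a_{is} a_{js}⁻¹ a_{is}⁻¹. -/

import Mathlib

open FreeGroup

namespace BraidPaper

/-- Relators for the Artin braid group on generators `σ_1, …, σ_n`
(so this presents the braid group `B_{n+1}`); the generator with index `k : Fin n`
represents `σ_{k+1}`. -/
def braidRels (n : ℕ) : Set (FreeGroup (Fin n)) :=
  {x | ∃ k l : Fin n, ((k : ℕ) + 2 ≤ (l : ℕ) ∨ (l : ℕ) + 2 ≤ (k : ℕ)) ∧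
      x = of k * of l * (of k)⁻¹ * (of l)⁻¹} ∪
  {x | ∃ k l : Fin n, (l : ℕ) = (k : ℕ) + 1 ∧
      x = of k * of l * of k * (of l)⁻¹ * (of k)⁻¹ * (of l)⁻¹}

/-- The braid group with `n` generators `σ_1, …, σ_n`, i.e. the Artin braid group
`B_{n+1}`.  Thus `B_N = BraidGroup (N-1)`. -/
abbrev BraidGroup (n : ℕ) : Type := PresentedGroup (braidRels n)

/-- The generator `σ_k` (1-based) of `BraidGroup n`, for `1 ≤ k ≤ n`. -/
def sgen (n k : ℕ) : BraidGroup n :=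
  if h : 1 ≤ k ∧ k ≤ n then PresentedGroup.of ⟨k - 1, by omega⟩ else 1

/-- The descending product `σ_{j-1} σ_{j-2} ⋯ σ_{i+1}`. -/
def dprod (n i j : ℕ) : BraidGroup n :=
  ((List.range (j - 1 - i)).map fun t => sgen n (j - 1 - t)).prod

/-- The pure braid generator
`a_{ij} = σ_{j-1} σ_{j-2} ⋯ σ_{i+1} σ_i² σ_{i+1}⁻¹ ⋯ σ_{j-2}⁻¹ σ_{j-1}⁻¹`. -/
def agen (n i j : ℕ) : BraidGroup n := dprod n i j * (sgen n i) ^ 2 * (dprod n i j)⁻¹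
theorem commute_sgen (n : ℕ) {k l : ℕ} (h : k + 2 ≤ l) : Commute (sgen n l) (sgen n k) := by
  unfold sgen
  split_ifs with hl hk
  · have hr := PresentedGroup.one_of_mem (rels := braidRels n)
      (Or.inl ⟨⟨l - 1, by omega⟩, ⟨k - 1, by omega⟩, Or.inr (by simp only; omega), rfl⟩)
    simp only [_root_.map_mul, _root_.map_inv] at hr
    exact mul_inv_eq_iff_eq_mul.mp (mul_inv_eq_one.mp hr)
  · exact Commute.one_right _
  · exact Commute.one_left _
  · exact Commute.one_left _

theorem sgen_braid (n : ℕ) {k : ℕ} (hk : 1 ≤ k) (hn : k + 1 ≤ n) :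
    sgen n k * sgen n (k + 1) * sgen n k = sgen n (k + 1) * sgen n k * sgen n (k + 1) := by
  have hr := PresentedGroup.one_of_mem (rels := braidRels n)
    (Or.inr ⟨⟨k - 1, by omega⟩, ⟨k, by omega⟩, by simp only; omega, rfl⟩)
  simp only [_root_.map_mul, _root_.map_inv] at hr
  rw [sgen, dif_pos ⟨hk, by omega⟩, sgen, dif_pos ⟨by omega, hn⟩]
  exact mul_inv_eq_iff_eq_mul.mp (mul_inv_eq_iff_eq_mul.mp (mul_inv_eq_one.mp hr))

theorem agen_self_succ (n i : ℕ) : agen n i (i + 1) = sgen n i ^ 2 := by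
  simp [agen, dprod]

theorem dprod_succ (n : ℕ) {i j : ℕ} (h : i < j) :
    dprod n i (j + 1) = sgen n j * dprod n i j := by
  obtain ⟨m, rfl⟩ := Nat.exists_eq_add_of_lt h
  have h₁ : i + m + 1 + 1 - 1 - i = m + 1 := by omega
  have h₂ : i + m + 1 - 1 - i = m := by omega
  simp only [dprod, h₁, h₂, List.range_succ_eq_map, List.map_cons, List.prod_cons, List.map_map]
  congr 3
  funext t
  simp only [Function.comp_apply]
  congr 1
  omega

theorem agen_succ (n : ℕ) {i j : ℕ} (h : i < j) :
    agen n i (j + 1) = MulAut.conj (sgen n j) (agen n i j) := by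
  simp only [agen, dprod_succ n h, MulAut.conj_apply, mul_inv_rev, mul_assoc]

theorem commute_sgen_agen (n : ℕ) {i j k : ℕ} (hij : i < j) (hjk : j < k) :
    Commute (sgen n k) (agen n i j) := by
  induction j, hij using Nat.le_induction with
  | base =>
    rw [agen_self_succ]
    exact (commute_sgen n hjk).pow_right 2
  | succ j hij ih =>
    have hc := commute_sgen n hjk
    rw [agen_succ n hij, MulAut.conj_apply]
    exact (hc.mul_right (ih (by omega))).mul_right hc.inv_right

/-- In any group, a braid relation between `c` and `b` propagates the relation `cAcA = AcAc`
to the conjugate of `A` by `c`, provided `A` commutes with `b`. -/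
theorem commute_conj_of_braid {G : Type*} [Group G] {a b c : G} (hb : c * b * c = b * c * b)
    (hab : Commute b a) (h : Commute a (c * a * c)) :
    Commute (c * a * c⁻¹) (b * (c * a * c⁻¹) * b) := by
  have e₁ : c⁻¹ * b * c = b * c * b⁻¹ := by
    rw [eq_mul_inv_iff_mul_eq, mul_assoc, mul_assoc, inv_mul_eq_iff_eq_mul]
    simpa only [mul_assoc] using hb.symm
  have e₂ : b⁻¹ * c⁻¹ * b = c * b⁻¹ * c⁻¹ := by
    rw [eq_mul_inv_iff_mul_eq, eq_mul_inv_iff_mul_eq, mul_assoc, mul_assoc, mul_assoc,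
      inv_mul_eq_iff_eq_mul, inv_mul_eq_iff_eq_mul]
    simpa only [mul_assoc] using hb.symm
  have e₃ : b⁻¹ * a = a * b⁻¹ := hab.inv_left
  have key : c * a * c⁻¹ * b * (c * a * c⁻¹) = c * b * (a * c * a) * b⁻¹ * c⁻¹ :=
    calc c * a * c⁻¹ * b * (c * a * c⁻¹) = c * a * (c⁻¹ * b * c) * a * c⁻¹ := by group
      _ = c * (a * b) * c * (b⁻¹ * a) * c⁻¹ := by rw [e₁]; group
      _ = c * b * (a * c * a) * b⁻¹ * c⁻¹ := by rw [e₃, ← hab.eq]; group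
  calc c * a * c⁻¹ * (b * (c * a * c⁻¹) * b)
      = c * a * c⁻¹ * b * (c * a * c⁻¹) * b := by group
    _ = c * b * (a * c * a) * (b⁻¹ * c⁻¹ * b) := by rw [key]; group
    _ = c * b * (a * (c * a * c)) * b⁻¹ * c⁻¹ := by rw [e₂]; group
    _ = (c * b * c) * (a * c * a) * b⁻¹ * c⁻¹ := by rw [h.eq]; group
    _ = b * (c * b * (a * c * a) * b⁻¹ * c⁻¹) := by rw [hb]; group
    _ = b * (c * a * c⁻¹) * b * (c * a * c⁻¹) := by rw [← key]; group

theorem commute_agen_sgen_mul (n : ℕ) {i j : ℕ} (hi : 1 ≤ i) (hij : i < j) (hj : j ≤ n) :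
    Commute (agen n i j) (sgen n j * agen n i j * sgen n j) := by
  induction j, hij using Nat.le_induction with
  | base =>
    have hb := sgen_braid n hi hj
    rw [agen_self_succ]
    generalize sgen n i = a at hb
    generalize sgen n (i + 1) = b at hb
    have h : Commute a (b * a ^ 2 * b) :=
      calc a * (b * a ^ 2 * b) = (a * b * a) * a * b := by simp only [pow_two, mul_assoc]
        _ = b * a * (b * a * b) := by rw [hb]; simp only [mul_assoc]
        _ = b * a ^ 2 * b * a := by rw [← hb]; simp only [pow_two, mul_assoc]
    exact h.pow_left 2
  | succ j hij ih =>
    rw [agen_succ n hij, MulAut.conj_apply]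
    exact commute_conj_of_braid (sgen_braid n (by omega) hj)
      (commute_sgen_agen n hij (Nat.lt_succ_self j)) (ih (by omega))

/-- Pure braid relation P3:
`a_{ij}⁻¹ a_{is} a_{ij} = a_{is} a_{js} a_{is} a_{js}⁻¹ a_{is}⁻¹` for `i<j<s`. -/
theorem statement3 (N : ℕ) (hN : 2 ≤ N) (i j s : ℕ)
    (hi : 1 ≤ i) (hij : i < j) (hjs : j < s) (hs : s ≤ N) :
    (agen (N - 1) i j)⁻¹ * agen (N - 1) i s * agen (N - 1) i j =
      agen (N - 1) i s * agen (N - 1) j s * agen (N - 1) i s *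
        (agen (N - 1) j s)⁻¹ * (agen (N - 1) i s)⁻¹ := by
  induction s, hjs using Nat.le_induction with
  | base =>
    have h := commute_agen_sgen_mul (N - 1) hi hij (by omega)
    rw [agen_self_succ, agen_succ _ hij, MulAut.conj_apply]
    generalize agen (N - 1) i j = a at h
    generalize sgen (N - 1) j = b at h
    have hz : b * a * b * a = a * (b * a * b) := h.eq.symm
    have hzb : Commute b (b * a * b * a) := by
      rw [Commute, SemiconjBy]
      nth_rw 1 [hz]
      simp only [mul_assoc]
    have hza : Commute a (b * a * b * a) := h.mul_right (Commute.refl a)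
    have hzx := (hzb.mul_left hza).mul_left hzb.inv_left
    calc a⁻¹ * (b * a * b⁻¹) * a
        = a⁻¹ * (b * a * b⁻¹ * (b * a * b * a)) * (b * a * b * a)⁻¹ * a := by group
      _ = a⁻¹ * (a * (b * a * b) * (b * a * b⁻¹)) * (a * (b * a * b))⁻¹ * a := by
        rw [hzx.eq, hz]
      _ = b * a * b * (b * a * b⁻¹) * (b * a * b)⁻¹ := by
        rw [mul_inv_rev, mul_assoc, inv_mul_cancel_right, mul_assoc a, inv_mul_cancel_left]
      _ = b * a * b⁻¹ * b ^ 2 * (b * a * b⁻¹) * (b ^ 2)⁻¹ * (b * a * b⁻¹)⁻¹ := by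
        simp only [pow_two, mul_inv_rev, inv_inv, mul_assoc, inv_mul_cancel_left]
  | succ s hjs ih =>
    have hc : MulAut.conj (sgen (N - 1) s) (agen (N - 1) i j) = agen (N - 1) i j := by
      rw [MulAut.conj_apply, mul_inv_eq_iff_eq_mul]
      exact commute_sgen_agen (N - 1) hij hjs
    have h := congrArg (MulAut.conj (sgen (N - 1) s)) (ih (by omega))
    simpa only [_root_.map_mul, _root_.map_inv, hc, ← agen_succ (N - 1) (hij.trans hjs),
      ← agen_succ (N - 1) hjs] using h

end BraidPaper
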